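/- arXiv:2404.17349 — 4 statements merged into one kernel-verified Lean document; each statement's English description precedes it below -/
import Mathlib

section
/- Let n ≥ 2 and define f_≍(X) = #{I interval of [n] : I ⊄ X and I ⊄ [n]∖X} for X ⊆ [n]. The facet description of the weak rectangulotope WRP(n) = {x ∈ ℝ^n : Σ_{i∈[n]} x_i = 0 and Σ_{i∈X} x_i ≤ f_≍(X) for all ∅ ≠ X ⊊ [n]} is irredundant: for every nonempty proper subset X ⊊ [n], there exists x ∈ ℝ^n with Σ_{i∈[n]} x_i = 0, Σ_{i∈Y} x_i ≤ f_≍(Y) for every nonempty proper subset Y ⊊ [n] with Y ≠ X, and Σ_{i∈X} x_i > f_≍(X). Consequently WRP(n) has exactly 2^n − 2 facets, the maximal possible number of facets of a deformed permutahedron. -/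
open Classical Pointwise

noncomputable section

/-- An interval of `[n]`: a nonempty set of consecutive integers. -/
def IsInterval {n : ℕ} (I : Finset (Fin n)) : Prop :=
  I.Nonempty ∧ ∀ a b c : Fin n, a ∈ I → c ∈ I → a ≤ b → b ≤ c → b ∈ I

/-- Two intervals `I`, `J` of `[n]` are consecutive if `max I = min J − 1`. -/
def ConsecIntervals {n : ℕ} (I J : Finset (Fin n)) : Prop :=
  ∃ (hI : IsInterval I) (hJ : IsInterval J),
    (I.max' hI.1 : ℕ) + 1 = (J.min' hJ.1 : ℕ)

/-- The standard basis vector `e i` of `ℝ^n`. -/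
def stdVec (n : ℕ) (i : Fin n) : Fin n → ℝ := fun k => if k = i then 1 else 0

/-- `f_≍(X)`: number of intervals of `[n]` contained neither in `X` nor in its complement. -/
def fWeak (n : ℕ) (X : Finset (Fin n)) : ℕ :=
  {I : Finset (Fin n) | IsInterval I ∧ ¬ I ⊆ X ∧ ¬ I ⊆ Xᶜ}.ncard

/-- `f_⥮(X)`. -/
def fStrong (n : ℕ) (X : Finset (Fin n)) : ℕ :=
  {p : Finset (Fin n) × Finset (Fin n) |
      ConsecIntervals p.1 p.2 ∧ ¬ p.1 ⊆ X ∧ ¬ p.2 ⊆ Xᶜ}.ncard +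
  {p : Finset (Fin n) × Finset (Fin n) |
      ConsecIntervals p.1 p.2 ∧ ¬ p.1 ⊆ Xᶜ ∧ ¬ p.2 ⊆ X}.ncard


/-- `F` is a face of the convex set `P`. -/
def IsFaceOf {n : ℕ} (P F : Set (Fin n → ℝ)) : Prop :=
  F ⊆ P ∧ Convex ℝ F ∧ ∀ x ∈ P, ∀ y ∈ P, ∀ t : ℝ, 0 < t → t < 1 →
    t • x + (1 - t) • y ∈ F → x ∈ F ∧ y ∈ F

/-- `F` is a facet of the polytope `P`: a nonempty face of codimension 1. -/
def IsFacetOf {n : ℕ} (P F : Set (Fin n → ℝ)) : Prop :=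
  IsFaceOf P F ∧ F.Nonempty ∧
    Module.finrank ℝ (vectorSpan ℝ F) + 1 = Module.finrank ℝ (vectorSpan ℝ P)

/-- The weak rectangulotope `WRP(n)`, given by its H-description. -/
def WRP (n : ℕ) : Set (Fin n → ℝ) :=
  {x | (∑ i, x i) = 0 ∧ ∀ X : Finset (Fin n), X.Nonempty → X ≠ Finset.univ →
    (∑ i ∈ X, x i) ≤ (fWeak n X : ℝ)}

lemma wr_eps {ι : Type*} [Finite ι] (Q : ι → Prop) (c d b : ι → ℝ)
    (h : ∀ j, Q j → c j < b j) : ∃ ε : ℝ, 0 < ε ∧ ∀ j, Q j → c j + ε * d j ≤ b j := by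
  have key : ∀ᶠ ε : ℝ in nhdsWithin 0 (Set.Ioi 0), ∀ j, Q j → c j + ε * d j ≤ b j := by
    rw [Filter.eventually_all]
    intro j
    by_cases hj : Q j
    · have hc : Filter.Tendsto (fun ε : ℝ => c j + ε * d j) (nhds 0) (nhds (c j + 0 * d j)) := by
        apply Continuous.tendsto (f := fun ε : ℝ => c j + ε * d j)
        fun_prop
      have := hc.eventually (eventually_lt_nhds (b := b j) (by simpa using h j hj))
      filter_upwards [nhdsWithin_le_nhds this] with ε hε _ using hε.le
    · exact Filter.Eventually.of_forall fun _ hq => absurd hq hj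
  obtain ⟨ε, h1, h2⟩ := (key.and self_mem_nhdsWithin).exists
  exact ⟨ε, h2, h1⟩

/-- A polyhedron inside the subspace `V`. -/
def wrPoly {n : ℕ} {ι : Type*} (V : Submodule ℝ (Fin n → ℝ)) (a : ι → (Fin n → ℝ) →ₗ[ℝ] ℝ)
    (b : ι → ℝ) : Set (Fin n → ℝ) := {x | x ∈ V ∧ ∀ j, a j x ≤ b j}

/-- The face of `wrPoly` where the inequalities of `T` are tight. -/
def wrFace {n : ℕ} {ι : Type*} (V : Submodule ℝ (Fin n → ℝ)) (a : ι → (Fin n → ℝ) →ₗ[ℝ] ℝ)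
    (b : ι → ℝ) (T : Set ι) : Set (Fin n → ℝ) := {x | x ∈ wrPoly V a b ∧ ∀ j ∈ T, a j x = b j}

section poly
variable {n : ℕ} {ι : Type*} (V : Submodule ℝ (Fin n → ℝ)) (a : ι → (Fin n → ℝ) →ₗ[ℝ] ℝ)
    (b : ι → ℝ)

lemma wrFace_isFace (T : Set ι) : IsFaceOf (wrPoly V a b) (wrFace V a b T) := by
  refine ⟨fun x hx => hx.1, ?_, ?_⟩
  · intro x hx y hy s t hs ht hst
    refine ⟨⟨V.add_mem (V.smul_mem _ hx.1.1) (V.smul_mem _ hy.1.1), fun j => ?_⟩, fun j hj => ?_⟩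
    · have h1 := hx.1.2 j
      have h2 := hy.1.2 j
      simp only [map_add, map_smul, smul_eq_mul]
      have : b j = s * b j + t * b j := by rw [← add_mul, hst, one_mul]
      rw [this]
      gcongr
    · simp only [map_add, map_smul, smul_eq_mul, hx.2 j hj, hy.2 j hj]
      rw [← add_mul, hst, one_mul]
  · intro x hx y hy t h0 h1 hF
    have key : ∀ j ∈ T, a j x = b j ∧ a j y = b j := by
      intro j hj
      have h := hF.2 j hj
      simp only [map_add, map_smul, smul_eq_mul] at h
      have hx' := hx.2 j
      have hy' := hy.2 j
      constructor
      · apply le_antisymm hx'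
        nlinarith
      · apply le_antisymm hy'
        nlinarith
    exact ⟨⟨hx, fun j hj => (key j hj).1⟩, ⟨hy, fun j hj => (key j hj).2⟩⟩

lemma wrFace_span [Finite ι] (T : Set ι) (p : Fin n → ℝ) (hp : p ∈ wrFace V a b T)
    (hs : ∀ j, j ∉ T → a j p < b j) (v : Fin n → ℝ) :
    v ∈ vectorSpan ℝ (wrFace V a b T) ↔ v ∈ V ∧ ∀ j ∈ T, a j v = 0 := by
  constructor
  · intro hv
    let W : Submodule ℝ (Fin n → ℝ) := V ⊓ ⨅ j ∈ T, LinearMap.ker (a j)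
    have hW : ∀ v, v ∈ W ↔ v ∈ V ∧ ∀ j ∈ T, a j v = 0 := by
      intro v; simp [W, Submodule.mem_iInf]
    rw [← hW]
    have : vectorSpan ℝ (wrFace V a b T) ≤ W := by
      rw [vectorSpan, Submodule.span_le]
      rintro _ ⟨x, hx, y, hy, rfl⟩
      simp only [SetLike.mem_coe, hW, vsub_eq_sub]
      refine ⟨V.sub_mem hx.1.1 hy.1.1, fun j hj => ?_⟩
      rw [map_sub, hx.2 j hj, hy.2 j hj, sub_self]
    exact this hv
  · rintro ⟨hV, hT⟩
    obtain ⟨ε, h0, hε⟩ := wr_eps (fun j => j ∉ T) (fun j => a j p) (fun j => a j v) b hs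
    have hm : p + ε • v ∈ wrFace V a b T := by
      refine ⟨⟨V.add_mem hp.1.1 (V.smul_mem _ hV), fun j => ?_⟩, fun j hj => ?_⟩
      · by_cases hj : j ∈ T
        · simp [hT j hj, hp.2 j hj]
        · simpa using hε j hj
      · simp [hT j hj, hp.2 j hj]
    have h1 := vsub_mem_vectorSpan ℝ hm hp
    have h2 := Submodule.smul_mem _ ε⁻¹ h1
    simpa [h0.ne'] using h2

lemma wrFace_sub [Finite ι] (T : Set ι) (F : Set (Fin n → ℝ)) (hF : IsFaceOf (wrPoly V a b) F)
    (q : Fin n → ℝ) (hq : q ∈ F) (hqT : ∀ j ∈ T, a j q = b j)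
    (hs : ∀ j, j ∉ T → a j q < b j) : wrFace V a b T ⊆ F := by
  intro y hy
  obtain ⟨ε, h0, hε⟩ := wr_eps (fun j => j ∉ T) (fun j => a j q) (fun j => a j (q - y)) b hs
  have hqP := hF.1 hq
  have hz : q + ε • (q - y) ∈ wrPoly V a b := by
    refine ⟨V.add_mem hqP.1 (V.smul_mem _ (V.sub_mem hqP.1 hy.1.1)), fun j => ?_⟩
    by_cases hj : j ∈ T
    · simp [hqT j hj, hy.2 j hj]
    · simpa using hε j hj
  have h1 : (0:ℝ) < 1 + ε := by linarith
  refine (hF.2.2 y hy.1 _ hz (ε / (1 + ε)) (by positivity) ?_ ?_).1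
  · rw [div_lt_one h1]; linarith
  · convert hq using 1
    ext k
    simp only [Pi.add_apply, Pi.smul_apply, Pi.sub_apply, smul_eq_mul]
    field_simp
    ring

lemma wr_avg [Finite ι] (T : Set ι) (F : Set (Fin n → ℝ)) (hF : IsFaceOf (wrPoly V a b) F)
    (hne : F.Nonempty) (h : ∀ j, j ∉ T → ∃ x ∈ F, a j x < b j) :
    ∃ q ∈ F, ∀ j, j ∉ T → a j q < b j := by
  have := Fintype.ofFinite ι
  suffices H : ∀ s : Finset ι, ∃ q ∈ F, ∀ j ∈ s, j ∉ T → a j q < b j by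
    obtain ⟨q, hq, h⟩ := H Finset.univ
    exact ⟨q, hq, fun j => h j (Finset.mem_univ _)⟩
  intro s
  induction s using Finset.induction_on with
  | empty => obtain ⟨x, hx⟩ := hne; exact ⟨x, hx, by simp⟩
  | insert i s hi ih =>
    obtain ⟨q, hq, hs⟩ := ih
    by_cases hiT : i ∈ T
    · refine ⟨q, hq, fun j hj hjT => ?_⟩
      rcases Finset.mem_insert.1 hj with rfl | hj
      · exact absurd hiT hjT
      · exact hs j hj hjT
    · obtain ⟨x, hx, hlt⟩ := h i hiT
      refine ⟨(1/2 : ℝ) • q + (1/2 : ℝ) • x,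
        hF.2.1 hq hx (by norm_num) (by norm_num) (by norm_num), fun j hj hjT => ?_⟩
      have h1 := (hF.1 hq).2 j
      have h2 := (hF.1 hx).2 j
      simp only [map_add, map_smul, smul_eq_mul]
      rcases Finset.mem_insert.1 hj with rfl | hj
      · linarith
      · have := hs j hj hjT
        linarith

lemma wr_facets [Finite ι] (hb : ∀ j, 0 < b j) (p : ι → Fin n → ℝ) (hpV : ∀ i, p i ∈ V)
    (hpi : ∀ i, a i (p i) = b i) (hpj : ∀ i j, j ≠ i → a j (p i) < b j) :
    {F : Set (Fin n → ℝ) | IsFacetOf (wrPoly V a b) F}.ncard = Nat.card ι := by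
  have hpF : ∀ i, p i ∈ wrFace V a b {i} := by
    intro i
    refine ⟨⟨hpV i, fun j => ?_⟩, fun j hj => ?_⟩
    · by_cases hj : j = i
      · subst hj; exact (hpi j).le
      · exact (hpj i j hj).le
    · rw [Set.mem_singleton_iff.1 hj]; exact hpi i
  have hP : wrFace V a b ∅ = wrPoly V a b := by
    ext x; simp [wrFace]
  have h0 : (0 : Fin n → ℝ) ∈ wrFace V a b ∅ :=
    ⟨⟨V.zero_mem, fun j => by simpa using (hb j).le⟩, by simp⟩
  have hspanP : vectorSpan ℝ (wrPoly V a b) = V := by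
    ext v
    rw [← hP, wrFace_span V a b ∅ 0 h0 (fun j _ => by simpa using hb j)]
    simp
  have hspanF : ∀ i v, v ∈ vectorSpan ℝ (wrFace V a b {i}) ↔ v ∈ V ∧ a i v = 0 := by
    intro i v
    rw [wrFace_span V a b {i} (p i) (hpF i) (fun j hj => hpj i j (by simpa using hj))]
    simp
  have hdim : ∀ i, Module.finrank ℝ (vectorSpan ℝ (wrFace V a b {i})) + 1 =
      Module.finrank ℝ V := by
    intro i
    let g : V →ₗ[ℝ] ℝ := (a i).comp V.subtype
    have hg : Function.Surjective g := by
      apply LinearMap.surjective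
      intro h
      have := LinearMap.congr_fun h ⟨p i, hpV i⟩
      simp only [g, LinearMap.comp_apply, Submodule.subtype_apply, hpi,
        LinearMap.zero_apply] at this
      exact (hb i).ne' this
    have h1 := LinearMap.finrank_range_add_finrank_ker g
    rw [LinearMap.range_eq_top.2 hg, finrank_top, Module.finrank_self] at h1
    have h2 : vectorSpan ℝ (wrFace V a b {i}) = (LinearMap.ker g).map V.subtype := by
      ext v
      rw [hspanF]
      simp [g, and_comm]
    rw [h2, Submodule.finrank_map_subtype_eq]
    omega
  have himg : {F : Set (Fin n → ℝ) | IsFacetOf (wrPoly V a b) F} =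
      Set.range (fun i => wrFace V a b {i}) := by
    ext F
    constructor
    · rintro ⟨hF, hne, hd⟩
      rw [hspanP] at hd
      have hex : ∃ i, F ⊆ wrFace V a b {i} := by
        by_contra! hcon
        obtain ⟨q, hq, hs⟩ := wr_avg V a b ∅ F hF hne (fun j _ => by
          obtain ⟨x, hx, hxn⟩ := Set.not_subset.1 (hcon j)
          refine ⟨x, hx, lt_of_le_of_ne ((hF.1 hx).2 j) fun he => hxn ⟨hF.1 hx, ?_⟩⟩
          simpa using he)
        have := wrFace_sub V a b ∅ F hF q hq (by simp) hs
        rw [hP] at this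
        have hEq : F = wrPoly V a b := Set.Subset.antisymm hF.1 this
        rw [hEq, hspanP] at hd
        omega
      obtain ⟨i, hi⟩ := hex
      refine ⟨i, Set.Subset.antisymm ?_ hi⟩
      have hsp : vectorSpan ℝ F = vectorSpan ℝ (wrFace V a b {i}) := by
        apply Submodule.eq_of_le_of_finrank_eq (vectorSpan_mono ℝ hi)
        have := hdim i
        omega
      obtain ⟨q, hq, hs⟩ := wr_avg V a b {i} F hF hne (fun j hj => by
        by_contra! hcon
        have hall : ∀ x ∈ F, a j x = b j := fun x hx =>
          le_antisymm ((hF.1 hx).2 j) (hcon x hx)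
        obtain ⟨y, hy⟩ := hne
        have h1 : p i - y ∈ vectorSpan ℝ F := by
          rw [hsp]; exact vsub_mem_vectorSpan ℝ (hpF i) (hi hy)
        have h2 : vectorSpan ℝ F ≤ LinearMap.ker (a j) := by
          rw [vectorSpan, Submodule.span_le]
          rintro _ ⟨x, hx, z, hz, rfl⟩
          simp [hall x hx, hall z hz]
        have h3 := h2 h1
        rw [LinearMap.mem_ker, map_sub, hall y hy] at h3
        have := hpj i j (by simpa using hj)
        linarith)
      exact wrFace_sub V a b {i} F hF q hq (fun j hj => (hi hq).2 j hj) hs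
    · rintro ⟨i, rfl⟩
      refine ⟨wrFace_isFace V a b {i}, ⟨p i, hpF i⟩, ?_⟩
      rw [hspanP]
      exact hdim i
  rw [himg, ← Set.image_univ, Set.ncard_image_of_injective, Set.ncard_univ]
  intro i j hij
  by_contra hne
  have h1 : p i ∈ wrFace V a b {j} := by
    have := hpF i
    simp only at hij
    rwa [hij] at this
  have h2 := h1.2 j rfl
  have h3 := hpj i j (Ne.symm hne)
  linarith

end poly

/-- `I` is split by `X`. -/
def wrSplit {n : ℕ} (I X : Finset (Fin n)) : Prop := ¬ I ⊆ X ∧ ¬ I ⊆ Xᶜ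

/-- The contribution of `I` to the point attached to `X`. -/
def wrW {n : ℕ} (X I : Finset (Fin n)) (k : Fin n) : ℝ :=
  if wrSplit I X then (if k ∈ I ∩ X then ((I ∩ X).card : ℝ)⁻¹ else 0) -
    (if k ∈ I \ X then ((I \ X).card : ℝ)⁻¹ else 0) else 0

/-- A point in the relative interior of the facet attached to `X`. -/
def wrPt {n : ℕ} (X : Finset (Fin n)) (k : Fin n) : ℝ :=
  ∑ I : Finset (Fin n) with IsInterval I, wrW X I k

lemma wrPt_sum {n : ℕ} (X Y : Finset (Fin n)) :
    ∑ k ∈ Y, wrPt X k = ∑ I : Finset (Fin n) with IsInterval I, ∑ k ∈ Y, wrW X I k := by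
  unfold wrPt
  exact Finset.sum_comm

lemma fWeak_sum {n : ℕ} (X : Finset (Fin n)) :
    (fWeak n X : ℝ) = ∑ I : Finset (Fin n) with IsInterval I, if wrSplit I X then (1:ℝ) else 0 := by
  have : {I : Finset (Fin n) | IsInterval I ∧ ¬ I ⊆ X ∧ ¬ I ⊆ Xᶜ} =
      ((Finset.univ.filter fun I : Finset (Fin n) => IsInterval I).filter
        fun I => wrSplit I X : Finset (Finset (Fin n))) := by
    ext I
    rw [Finset.mem_coe, Finset.mem_filter, Finset.mem_filter]
    simp [wrSplit]
  rw [fWeak, this, Set.ncard_coe_finset, Finset.sum_ite]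
  simp

lemma wrSplit_pos {n : ℕ} {I X : Finset (Fin n)} (h : wrSplit I X) :
    0 < ((I ∩ X).card : ℝ) ∧ 0 < ((I \ X).card : ℝ) := by
  obtain ⟨h1, h2⟩ := h
  obtain ⟨u, hu, hu'⟩ := Finset.not_subset.1 h1
  obtain ⟨v, hv, hv'⟩ := Finset.not_subset.1 h2
  constructor
  · exact_mod_cast Finset.card_pos.2 ⟨v, by simp_all⟩
  · exact_mod_cast Finset.card_pos.2 ⟨u, by simp_all⟩

lemma wrW_sum {n : ℕ} (X I Y : Finset (Fin n)) (h : wrSplit I X) :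
    ∑ k ∈ Y, wrW X I k = ((Y ∩ (I ∩ X)).card : ℝ) / ((I ∩ X).card : ℝ) -
      ((Y ∩ (I \ X)).card : ℝ) / ((I \ X).card : ℝ) := by
  simp only [wrW, if_pos h, Finset.sum_sub_distrib, Finset.sum_ite_mem, Finset.sum_const,
    nsmul_eq_mul, div_eq_mul_inv]

lemma wrW_eq {n : ℕ} (X I : Finset (Fin n)) :
    ∑ k ∈ X, wrW X I k = if wrSplit I X then (1:ℝ) else 0 := by
  by_cases h : wrSplit I X
  · obtain ⟨h1, h2⟩ := wrSplit_pos h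
    have e1 : X ∩ (I ∩ X) = I ∩ X := by ext; simp
    have e2 : X ∩ (I \ X) = ∅ := by ext; simp
    rw [wrW_sum _ _ _ h, if_pos h, e1, e2, div_self h1.ne']
    simp
  · simp [wrW, h]

lemma wrW_univ {n : ℕ} (X I : Finset (Fin n)) :
    ∑ k, wrW X I k = 0 := by
  by_cases h : wrSplit I X
  · obtain ⟨h1, h2⟩ := wrSplit_pos h
    rw [wrW_sum _ _ _ h, Finset.univ_inter, Finset.univ_inter, div_self h1.ne', div_self h2.ne',
      sub_self]
  · simp [wrW, h]

lemma wrW_le {n : ℕ} (X I Y : Finset (Fin n)) :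
    ∑ k ∈ Y, wrW X I k ≤ if wrSplit I Y then (1:ℝ) else 0 := by
  by_cases h : wrSplit I X
  · obtain ⟨h1, h2⟩ := wrSplit_pos h
    rw [wrW_sum _ _ _ h]
    by_cases hY : wrSplit I Y
    · rw [if_pos hY]
      have : ((Y ∩ (I ∩ X)).card : ℝ) / ((I ∩ X).card : ℝ) ≤ 1 := by
        rw [div_le_one h1]
        exact_mod_cast Finset.card_le_card Finset.inter_subset_right
      have : 0 ≤ ((Y ∩ (I \ X)).card : ℝ) / ((I \ X).card : ℝ) := by positivity
      linarith
    · rw [if_neg hY]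
      have hY' : I ⊆ Y ∨ I ⊆ Yᶜ := by unfold wrSplit at hY; tauto
      rcases hY' with hY' | hY'
      · have e1 : Y ∩ (I ∩ X) = I ∩ X := by ext x; have := @hY' x; simp; tauto
        have e2 : Y ∩ (I \ X) = I \ X := by ext x; have := @hY' x; simp; tauto
        rw [e1, e2, div_self h1.ne', div_self h2.ne', sub_self]
      · have e1 : Y ∩ (I ∩ X) = ∅ := by ext x; have := @hY' x; simp at *; tauto
        have e2 : Y ∩ (I \ X) = ∅ := by ext x; have := @hY' x; simp at *; tauto
        simp [e1, e2]
  · simp only [wrW, if_neg h, Finset.sum_const_zero]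
    split_ifs <;> norm_num

lemma wrSplit_univ {n : ℕ} {X : Finset (Fin n)} (h1 : X.Nonempty) (h2 : X ≠ Finset.univ) :
    wrSplit Finset.univ X := by
  constructor
  · intro h; exact h2 (Finset.univ_subset_iff.1 h)
  · intro h
    obtain ⟨x, hx⟩ := h1
    have := h (Finset.mem_univ x)
    simp at this
    exact this hx

lemma wr_interval_univ {n : ℕ} {X : Finset (Fin n)} (h1 : X.Nonempty) :
    IsInterval (Finset.univ : Finset (Fin n)) :=
  ⟨h1.mono (Finset.subset_univ _), fun _ _ _ _ _ _ _ => Finset.mem_univ _⟩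

lemma wrW_lt {n : ℕ} {X Y : Finset (Fin n)} (hX1 : X.Nonempty) (hX2 : X ≠ Finset.univ)
    (hY1 : Y.Nonempty) (hY2 : Y ≠ Finset.univ) (hXY : Y ≠ X) :
    ∑ k ∈ Y, wrW X Finset.univ k < if wrSplit Finset.univ Y then (1:ℝ) else 0 := by
  have h := wrSplit_univ hX1 hX2
  rw [if_pos (wrSplit_univ hY1 hY2), wrW_sum _ _ _ h]
  obtain ⟨h1, h2⟩ := wrSplit_pos h
  have l1 : ((Y ∩ (Finset.univ ∩ X)).card : ℝ) / ((Finset.univ ∩ X).card : ℝ) ≤ 1 := by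
    rw [div_le_one h1]
    exact_mod_cast Finset.card_le_card Finset.inter_subset_right
  have l2 : 0 ≤ ((Y ∩ (Finset.univ \ X)).card : ℝ) / ((Finset.univ \ X).card : ℝ) := by positivity
  by_cases hs : Y ⊆ X
  · have hns : ¬ X ⊆ Y := fun h => hXY (Finset.Subset.antisymm hs h)
    have : ((Y ∩ (Finset.univ ∩ X)).card : ℝ) / ((Finset.univ ∩ X).card : ℝ) < 1 := by
      rw [div_lt_one h1]
      have : Y ∩ (Finset.univ ∩ X) ⊂ Finset.univ ∩ X := by
        refine ⟨Finset.inter_subset_right, fun hh => hns fun x hx => ?_⟩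
        exact (Finset.mem_inter.1 (hh (by simpa using hx))).1
      exact_mod_cast Finset.card_lt_card this
    linarith
  · obtain ⟨y, hy, hy'⟩ := Finset.not_subset.1 hs
    have : 0 < ((Y ∩ (Finset.univ \ X)).card : ℝ) / ((Finset.univ \ X).card : ℝ) := by
      apply div_pos _ h2
      exact_mod_cast Finset.card_pos.2 ⟨y, by simp [hy, hy']⟩
    linarith

lemma wrPt_lt {n : ℕ} {X Y : Finset (Fin n)} (hX1 : X.Nonempty) (hX2 : X ≠ Finset.univ)
    (hY1 : Y.Nonempty) (hY2 : Y ≠ Finset.univ) (hXY : Y ≠ X) :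
    ∑ k ∈ Y, wrPt X k < (fWeak n Y : ℝ) := by
  rw [wrPt_sum, fWeak_sum]
  refine Finset.sum_lt_sum (fun I _ => wrW_le X I Y) ⟨Finset.univ, ?_, wrW_lt hX1 hX2 hY1 hY2 hXY⟩
  simpa using wr_interval_univ hX1

lemma wrPt_eq {n : ℕ} (X : Finset (Fin n)) : ∑ k ∈ X, wrPt X k = (fWeak n X : ℝ) := by
  rw [wrPt_sum, fWeak_sum]
  exact Finset.sum_congr rfl fun I _ => wrW_eq X I

lemma wrPt_univ {n : ℕ} (X : Finset (Fin n)) : ∑ k, wrPt X k = 0 := by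
  rw [wrPt_sum]
  exact Finset.sum_eq_zero fun I _ => wrW_univ X I

lemma fWeak_pos' {n : ℕ} {X : Finset (Fin n)} (hX1 : X.Nonempty) (hX2 : X ≠ Finset.univ) :
    0 < (fWeak n X : ℝ) := by
  rw [fWeak_sum]
  refine Finset.sum_pos' (fun I _ => by split_ifs <;> norm_num) ⟨Finset.univ, ?_, ?_⟩
  · simpa using wr_interval_univ hX1
  · rw [if_pos (wrSplit_univ hX1 hX2)]; norm_num

lemma wr_card {n : ℕ} (hn : 2 ≤ n) :
    Nat.card {X : Finset (Fin n) // X.Nonempty ∧ X ≠ Finset.univ} = 2 ^ n - 2 := by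
  have : NeZero n := ⟨by omega⟩
  rw [Nat.card_eq_fintype_card, Fintype.card_subtype]
  have : (Finset.univ.filter fun X : Finset (Fin n) => X.Nonempty ∧ X ≠ Finset.univ) =
      (Finset.univ : Finset (Finset (Fin n))) \ {∅, Finset.univ} := by
    ext X; simp [Finset.nonempty_iff_ne_empty]
  rw [this, Finset.card_sdiff_of_subset (Finset.subset_univ _), Finset.card_univ,
    Fintype.card_finset, Fintype.card_fin, Finset.card_pair]
  exact (Finset.univ_nonempty.ne_empty).symm

/-- the facet description of the weak rectangulotope is
irredundant: for every nonempty proper `X ⊊ [n]` there is a point satisfying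
all other inequalities but violating the one of `X`.  Consequently `WRP(n)`
has exactly `2^n − 2` facets. -/
theorem weak_rectangulotope_facets (n : ℕ) (hn : 2 ≤ n) :
    (∀ X : Finset (Fin n), X.Nonempty → X ≠ Finset.univ →
      ∃ x : Fin n → ℝ, (∑ i, x i) = 0 ∧
        (∀ Y : Finset (Fin n), Y.Nonempty → Y ≠ Finset.univ → Y ≠ X →
          (∑ i ∈ Y, x i) ≤ (fWeak n Y : ℝ)) ∧
        (fWeak n X : ℝ) < ∑ i ∈ X, x i) ∧
    {F : Set (Fin n → ℝ) | IsFacetOf (WRP n) F}.ncard = 2 ^ n - 2 := by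
  constructor
  · intro X h1 h2
    obtain ⟨ε, h0, hε⟩ := wr_eps
      (fun Y : Finset (Fin n) => Y.Nonempty ∧ Y ≠ Finset.univ ∧ Y ≠ X)
      (fun Y => ∑ k ∈ Y, wrPt X k) (fun Y => ∑ k ∈ Y, wrPt X k) (fun Y => (fWeak n Y : ℝ))
      (fun Y hY => wrPt_lt h1 h2 hY.1 hY.2.1 hY.2.2)
    have hsum : ∀ Y : Finset (Fin n), ∑ k ∈ Y, (wrPt X k + ε * wrPt X k) =
        ∑ k ∈ Y, wrPt X k + ε * ∑ k ∈ Y, wrPt X k := by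
      intro Y
      rw [Finset.sum_add_distrib, Finset.mul_sum]
    refine ⟨fun k => wrPt X k + ε * wrPt X k, ?_, ?_, ?_⟩
    · rw [hsum, wrPt_univ]; simp
    · intro Y hY1 hY2 hY3
      rw [hsum]
      exact hε Y ⟨hY1, hY2, hY3⟩
    · rw [hsum, wrPt_eq]
      have := mul_pos h0 (fWeak_pos' h1 h2)
      linarith
  · let ι := {X : Finset (Fin n) // X.Nonempty ∧ X ≠ Finset.univ}
    let s : Finset (Fin n) → (Fin n → ℝ) →ₗ[ℝ] ℝ := fun X => ∑ i ∈ X, LinearMap.proj i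
    have hs : ∀ X x, s X x = ∑ i ∈ X, x i := by
      intro X x; simp [s, LinearMap.sum_apply]
    have hW : WRP n = wrPoly (LinearMap.ker (s Finset.univ)) (fun X : ι => s X.1)
        (fun X : ι => (fWeak n X.1 : ℝ)) := by
      ext x
      simp only [WRP, wrPoly, Set.mem_ofPred_eq, LinearMap.mem_ker, hs]
      exact and_congr_right fun _ =>
        ⟨fun h X => h X.1 X.2.1 X.2.2, fun h X h1 h2 => h ⟨X, h1, h2⟩⟩
    rw [hW, wr_facets _ _ _ (fun X => fWeak_pos' X.2.1 X.2.2) (fun X => wrPt X.1), wr_card hn]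
    · intro X
      rw [LinearMap.mem_ker, hs]
      exact wrPt_univ _
    · intro X
      rw [hs]
      exact wrPt_eq _
    · intro X Y hne
      rw [hs]
      exact wrPt_lt X.2.1 X.2.2 Y.2.1 Y.2.2 fun h => hne (Subtype.ext h)

end
end

section
/- Let n ≥ 2 and define f_⥮(X) = #{(I,J) : I ⊄ X and J ⊄ [n]∖X} + #{(I,J) : I ⊄ [n]∖X and J ⊄ X} for X ⊆ [n], where (I,J) ranges over all pairs of nonempty consecutive intervals of [n]. The facet description of the strong rectangulotope SRP(n) = {x ∈ ℝ^n : Σ_{i∈[n]} x_i = 0 and Σ_{i∈X} x_i ≤ f_⥮(X) for all ∅ ≠ X ⊊ [n]} is irredundant: for every nonempty proper subset X ⊊ [n], there exists x ∈ ℝ^n with Σ_{i∈[n]} x_i = 0, Σ_{i∈Y} x_i ≤ f_⥮(Y) for every nonempty proper subset Y ⊊ [n] with Y ≠ X, and Σ_{i∈X} x_i > f_⥮(X). Consequently SRP(n) has exactly 2^n − 2 facets, the maximal possible number of facets of a deformed permutahedron. -/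
open Classical Pointwise

noncomputable section

/-- The strong rectangulotope `SRP(n)`, given by its H-description. -/
def SRP (n : ℕ) : Set (Fin n → ℝ) :=
  {x | (∑ i, x i) = 0 ∧ ∀ X : Finset (Fin n), X.Nonempty → X ≠ Finset.univ →
    (∑ i ∈ X, x i) ≤ (fStrong n X : ℝ)}

/-- Support function of the piece `conv {0, e_b - e_a}` evaluated at indicator vectors. -/
def pieceH {n : ℕ} (A B S : Finset (Fin n)) : ℝ :=
  if ¬ A ⊆ S ∧ ¬ B ⊆ Sᶜ then 1 else 0

/-- All pairs of consecutive intervals. -/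
def consecPairs (n : ℕ) : Finset (Finset (Fin n) × Finset (Fin n)) :=
  Finset.univ.filter fun p => ConsecIntervals p.1 p.2

lemma fStrong_eq_sum (n : ℕ) (X : Finset (Fin n)) :
    (fStrong n X : ℝ) = ∑ p ∈ consecPairs n, (pieceH p.1 p.2 X + pieceH p.2 p.1 X) := by
  have key : ∀ P : Finset (Fin n) × Finset (Fin n) → Prop,
      (({p : Finset (Fin n) × Finset (Fin n) | ConsecIntervals p.1 p.2 ∧ P p}.ncard : ℕ) : ℝ)
        = ∑ p ∈ consecPairs n, if P p then (1 : ℝ) else 0 := by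
    intro P
    rw [Finset.sum_boole, consecPairs, Finset.filter_filter, ← Set.ncard_coe_finset]
    congr 2
    ext p
    simp
  rw [fStrong, Finset.sum_add_distrib]
  push_cast
  rw [key, key]
  refine congrArg₂ _ (Finset.sum_congr rfl fun p _ => ?_) (Finset.sum_congr rfl fun p _ => ?_)
  · unfold pieceH; congr
  · unfold pieceH; by_cases h1 : p.1 ⊆ Xᶜ <;> by_cases h2 : p.2 ⊆ X <;> simp [h1, h2]

/-- A point of the base polytope of a piece. -/
def ValidPt {n : ℕ} (A B : Finset (Fin n)) (q : Fin n → ℝ) : Prop :=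
  ∑ i, q i = 0 ∧ ∀ S : Finset (Fin n), ∑ i ∈ S, q i ≤ pieceH A B S

lemma pieceH_nonneg {n : ℕ} (A B S : Finset (Fin n)) : 0 ≤ pieceH A B S := by
  unfold pieceH; split_ifs <;> norm_num

lemma validPt_zero {n : ℕ} (A B : Finset (Fin n)) : ValidPt A B (fun _ => 0) :=
  ⟨by simp, fun S => by simpa using pieceH_nonneg A B S⟩

/-- `e b - e a`. -/
def rootVec {n : ℕ} (b a : Fin n) : Fin n → ℝ :=
  fun k => (if k = b then 1 else 0) - (if k = a then 1 else 0)

lemma sum_rootVec {n : ℕ} (b a : Fin n) (S : Finset (Fin n)) :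
    ∑ i ∈ S, rootVec b a i = (if b ∈ S then 1 else 0) - (if a ∈ S then 1 else 0) := by
  simp [rootVec, Finset.sum_sub_distrib]

lemma validPt_root {n : ℕ} {A B : Finset (Fin n)} {a b : Fin n} (ha : a ∈ A) (hb : b ∈ B) :
    ValidPt A B (rootVec b a) := by
  refine ⟨by rw [sum_rootVec]; simp, fun S => ?_⟩
  rw [sum_rootVec]
  have h0 := pieceH_nonneg A B S
  by_cases h1 : b ∈ S <;> by_cases h2 : a ∈ S <;> simp only [h1, h2, if_true, if_false] <;>
    try linarith
  have : pieceH A B S = 1 := by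
    unfold pieceH
    rw [if_pos]
    refine ⟨fun h => h2 (h ha), fun h => ?_⟩
    have := h hb
    simp [h1] at this
  linarith

lemma exists_opt {n : ℕ} (X A B : Finset (Fin n)) :
    ∃ q, ValidPt A B q ∧ ∑ i ∈ X, q i = pieceH A B X := by
  by_cases h : ¬ A ⊆ X ∧ ¬ B ⊆ Xᶜ
  · obtain ⟨a, ha, haX⟩ := Finset.not_subset.1 h.1
    obtain ⟨b, hb, hbX⟩ := Finset.not_subset.1 h.2
    refine ⟨rootVec b a, validPt_root ha hb, ?_⟩
    rw [sum_rootVec, pieceH, if_pos h]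
    simp at hbX
    simp [haX, hbX]
  · exact ⟨_, validPt_zero A B, by simp [pieceH, if_neg h]⟩

/-- There is a point of the polytope tight at `X` and not tight at `Y`. -/
def GoodPair {n : ℕ} (X Y : Finset (Fin n)) : Prop :=
  ∃ p : Fin n → ℝ, ∑ i, p i = 0 ∧ (∀ S, ∑ i ∈ S, p i ≤ (fStrong n S : ℝ)) ∧
    ∑ i ∈ X, p i = (fStrong n X : ℝ) ∧ ∑ i ∈ Y, p i < (fStrong n Y : ℝ)

lemma exists_tight {n : ℕ} (X : Finset (Fin n)) :
    ∃ p : Fin n → ℝ, ∑ i, p i = 0 ∧ (∀ S, ∑ i ∈ S, p i ≤ (fStrong n S : ℝ)) ∧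
    ∑ i ∈ X, p i = (fStrong n X : ℝ) := by
  choose Q hQ hQX using exists_opt X
  refine ⟨fun i => ∑ p ∈ consecPairs n, (Q p.1 p.2 i + Q p.2 p.1 i), ?_, fun S => ?_, ?_⟩
  · rw [Finset.sum_comm]
    refine Finset.sum_eq_zero fun p _ => ?_
    rw [Finset.sum_add_distrib, (hQ _ _).1, (hQ _ _).1, add_zero]
  · rw [Finset.sum_comm, fStrong_eq_sum]
    refine Finset.sum_le_sum fun p _ => ?_
    rw [Finset.sum_add_distrib]
    exact add_le_add ((hQ _ _).2 S) ((hQ _ _).2 S)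
  · rw [Finset.sum_comm, fStrong_eq_sum]
    refine Finset.sum_congr rfl fun p _ => ?_
    rw [Finset.sum_add_distrib, hQX, hQX]

lemma good_of_piece {n : ℕ} {X Y A B : Finset (Fin n)}
    (hc : ConsecIntervals A B ∨ ConsecIntervals B A) {q : Fin n → ℝ} (hq : ValidPt A B q)
    (hX : ∑ i ∈ X, q i = pieceH A B X) (hY : ∑ i ∈ Y, q i < pieceH A B Y) : GoodPair X Y := by
  have hopt : ∀ C D : Finset (Fin n), ∃ r, ValidPt C D r ∧ ∑ i ∈ X, r i = pieceH C D X ∧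
      (C = A → D = B → ∑ i ∈ Y, r i < pieceH C D Y) := by
    intro C D
    by_cases h : C = A ∧ D = B
    · obtain ⟨rfl, rfl⟩ := h
      exact ⟨q, hq, hX, fun _ _ => hY⟩
    · obtain ⟨r, h1, h2⟩ := exists_opt X C D
      exact ⟨r, h1, h2, fun h3 h4 => absurd ⟨h3, h4⟩ h⟩
  choose Q hQ hQX hQY using hopt
  refine ⟨fun i => ∑ p ∈ consecPairs n, (Q p.1 p.2 i + Q p.2 p.1 i), ?_, fun S => ?_, ?_, ?_⟩
  · rw [Finset.sum_comm]
    refine Finset.sum_eq_zero fun p _ => ?_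
    rw [Finset.sum_add_distrib, (hQ _ _).1, (hQ _ _).1, add_zero]
  · rw [Finset.sum_comm, fStrong_eq_sum]
    refine Finset.sum_le_sum fun p _ => ?_
    rw [Finset.sum_add_distrib]
    exact add_le_add ((hQ _ _).2 S) ((hQ _ _).2 S)
  · rw [Finset.sum_comm, fStrong_eq_sum]
    refine Finset.sum_congr rfl fun p _ => ?_
    rw [Finset.sum_add_distrib, hQX, hQX]
  · rw [Finset.sum_comm, fStrong_eq_sum]
    refine Finset.sum_lt_sum (fun p _ => ?_) ?_
    · rw [Finset.sum_add_distrib]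
      exact add_le_add ((hQ _ _).2 Y) ((hQ _ _).2 Y)
    · rcases hc with hc | hc
      · refine ⟨(A, B), by simpa [consecPairs] using hc, ?_⟩
        rw [Finset.sum_add_distrib]
        exact add_lt_add_of_lt_of_le (hQY _ _ rfl rfl) ((hQ _ _).2 Y)
      · refine ⟨(B, A), by simpa [consecPairs] using hc, ?_⟩
        rw [Finset.sum_add_distrib]
        exact add_lt_add_of_le_of_lt ((hQ _ _).2 Y) (hQY _ _ rfl rfl)

lemma exists_consec {n : ℕ} {a c : Fin n} (h : a ≠ c) :
    ∃ J : Finset (Fin n), c ∈ J ∧ (ConsecIntervals {a} J ∨ ConsecIntervals J {a}) := by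
  have hI : IsInterval ({a} : Finset (Fin n)) := by
    refine ⟨by simp, fun u v w hu hw h1 h2 => ?_⟩
    simp only [Finset.mem_singleton] at *
    subst hu; subst hw
    exact le_antisymm h2 h1
  rcases lt_or_gt_of_ne h with h | h
  · have hJ : IsInterval (Finset.Ioc a c) := by
      refine ⟨⟨c, by simp [h]⟩, fun u v w hu hw h1 h2 => ?_⟩
      simp only [Finset.mem_Ioc] at *
      exact ⟨hu.1.trans_le h1, h2.trans hw.2⟩
    refine ⟨Finset.Ioc a c, by simp [h], Or.inl ⟨hI, hJ, ?_⟩⟩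
    have hlt : (a : ℕ) + 1 < n := lt_of_le_of_lt (Nat.succ_le_of_lt h) c.2
    have hmin : (Finset.Ioc a c).min' hJ.1 = ⟨a + 1, hlt⟩ := by
      refine le_antisymm (Finset.min'_le _ _ ?_) (Finset.le_min' _ _ _ fun y hy => ?_)
      · rw [Finset.mem_Ioc, Fin.lt_def, Fin.le_def]
        exact ⟨Nat.lt_succ_self _, Nat.succ_le_of_lt h⟩
      · exact Nat.succ_le_of_lt (Finset.mem_Ioc.1 hy).1
    rw [hmin, Finset.max'_singleton]
  · have hJ : IsInterval (Finset.Ico c a) := by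
      refine ⟨⟨c, by simp [h]⟩, fun u v w hu hw h1 h2 => ?_⟩
      simp only [Finset.mem_Ico] at *
      exact ⟨hu.1.trans h1, h2.trans_lt hw.2⟩
    refine ⟨Finset.Ico c a, by simp [h], Or.inr ⟨hJ, hI, ?_⟩⟩
    have h' : (c : ℕ) < a := h
    have hlt : (a : ℕ) - 1 < n := by have := a.2; omega
    have hmax : (Finset.Ico c a).max' hJ.1 = ⟨a - 1, hlt⟩ := by
      refine le_antisymm (Finset.max'_le _ _ _ fun y hy => ?_) (Finset.le_max' _ _ ?_)
      · have : (y : ℕ) < a := (Finset.mem_Ico.1 hy).2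
        rw [Fin.le_def]; simp only; omega
      · rw [Finset.mem_Ico, Fin.lt_def, Fin.le_def]
        simp only; omega
    rw [hmax, Finset.min'_singleton]
    simp only; omega

lemma good_pair {n : ℕ} {X Y : Finset (Fin n)} (hne : Y ≠ X) (hY : Y.Nonempty)
    (hYu : Y ≠ Finset.univ) : GoodPair X Y := by
  by_contra hG
  have P1 : ∀ a c, a ∈ X → c ∈ X → a ∈ Y → c ∈ Y := by
    intro a c ha hc haY
    by_contra hcY
    obtain ⟨J, hcJ, hJ⟩ := exists_consec (show a ≠ c by rintro rfl; exact hcY haY)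
    refine hG (good_of_piece hJ (validPt_root (Finset.mem_singleton_self a) hcJ) ?_ ?_)
    · rw [sum_rootVec]; simp [pieceH, ha, hc]
    · rw [sum_rootVec]; simp [pieceH, haY, hcY]
  have P2 : ∀ a c, a ∉ X → c ∉ X → a ∉ Y → c ∉ Y := by
    intro a c ha hc haY hcY
    obtain ⟨J, hcJ, hJ⟩ := exists_consec (show a ≠ c by rintro rfl; exact haY hcY)
    refine hG (good_of_piece hJ.symm (validPt_root hcJ (Finset.mem_singleton_self a)) ?_ ?_)
    · rw [sum_rootVec]; simp [pieceH, ha, hc]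
    · rw [sum_rootVec]; simp [pieceH, haY, hcY]
  have P3 : ∀ a c, a ∈ X → c ∉ X → a ∉ Y → c ∉ Y := by
    intro a c ha hc haY hcY
    obtain ⟨J, hcJ, hJ⟩ := exists_consec (show a ≠ c by rintro rfl; exact haY hcY)
    refine hG (good_of_piece hJ.symm (validPt_root hcJ (Finset.mem_singleton_self a)) ?_ ?_)
    · rw [sum_rootVec]
      have : ¬ J ⊆ X := fun h => hc (h hcJ)
      simp [pieceH, ha, hc, this]
    · rw [sum_rootVec]; simp [pieceH, haY, hcY]
  apply hne
  obtain ⟨v, hv⟩ := hY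
  obtain ⟨w, hw⟩ : ∃ w, w ∉ Y := by
    by_contra h
    push Not at h
    exact hYu (Finset.eq_univ_iff_forall.2 h)
  ext u
  constructor
  · intro hu
    by_contra huX
    by_cases hwX : w ∈ X
    · exact P3 w u hwX huX hw hu
    · exact P2 w u hwX huX hw hu
  · intro hu
    by_contra huY
    by_cases hvX : v ∈ X
    · exact huY (P1 v u hvX hu hv)
    · exact P3 u v hu hvX huY hv

/-- A point tight exactly at `X`. -/
lemma exists_relint {n : ℕ} (X : Finset (Fin n)) :
    ∃ p : Fin n → ℝ, ∑ i, p i = 0 ∧ ∑ i ∈ X, p i = (fStrong n X : ℝ) ∧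
      (∀ S, ∑ i ∈ S, p i ≤ (fStrong n S : ℝ)) ∧
      ∀ Y : Finset (Fin n), Y.Nonempty → Y ≠ Finset.univ → Y ≠ X →
        ∑ i ∈ Y, p i < (fStrong n Y : ℝ) := by
  have h : ∀ Y : Finset (Fin n), ∃ p : Fin n → ℝ, ∑ i, p i = 0 ∧
      (∀ S, ∑ i ∈ S, p i ≤ (fStrong n S : ℝ)) ∧ ∑ i ∈ X, p i = (fStrong n X : ℝ) ∧
      (Y.Nonempty → Y ≠ Finset.univ → Y ≠ X → ∑ i ∈ Y, p i < (fStrong n Y : ℝ)) := by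
    intro Y
    by_cases hY : Y.Nonempty ∧ Y ≠ Finset.univ ∧ Y ≠ X
    · obtain ⟨p, h1, h2, h3, h4⟩ := good_pair hY.2.2 hY.1 hY.2.1
      exact ⟨p, h1, h2, h3, fun _ _ _ => h4⟩
    · obtain ⟨p, h1, h2, h3⟩ := exists_tight X
      exact ⟨p, h1, h2, h3, fun a b c => absurd ⟨a, b, c⟩ hY⟩
  choose p h1 h2 h3 h4 using h
  set N : ℝ := (Fintype.card (Finset (Fin n)) : ℝ) with hN
  have hNpos : 0 < N := by rw [hN]; exact_mod_cast Fintype.card_pos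
  have hsum : ∀ S : Finset (Fin n), ∑ i ∈ S, (∑ Z, p Z i) / N = (∑ Z, ∑ i ∈ S, p Z i) / N := by
    intro S
    rw [← Finset.sum_div, Finset.sum_comm]
  have hconst : ∀ c : ℝ, ∑ _Z : Finset (Fin n), c = c * N := by
    intro c
    rw [Finset.sum_const, nsmul_eq_mul, Finset.card_univ, hN, mul_comm]
  refine ⟨fun i => (∑ Z, p Z i) / N, ?_, ?_, fun S => ?_, fun Y hY hYu hYX => ?_⟩
  · rw [hsum, Finset.sum_congr rfl (fun Z _ => h1 Z)]; simp
  · rw [hsum, Finset.sum_congr rfl (fun Z _ => h3 Z), hconst, mul_div_cancel_right₀ _ hNpos.ne']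
  · rw [hsum, div_le_iff₀ hNpos, ← hconst]
    exact Finset.sum_le_sum fun Z _ => h2 Z S
  · rw [hsum, div_lt_iff₀ hNpos, ← hconst]
    exact Finset.sum_lt_sum (fun Z _ => h2 Z Y) ⟨Y, Finset.mem_univ _, h4 Y hY hYu hYX⟩

/-- Small perturbations preserve strict inequalities. -/
lemma exists_eps {n : ℕ} (p v : Fin n → ℝ) : ∃ ε : ℝ, 0 < ε ∧ ∀ S : Finset (Fin n),
    ∑ i ∈ S, p i < (fStrong n S : ℝ) → ∑ i ∈ S, (p + ε • v) i ≤ (fStrong n S : ℝ) := by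
  have h : ∀ᶠ ε : ℝ in nhdsWithin 0 (Set.Ioi 0), ∀ S : Finset (Fin n),
      ∑ i ∈ S, p i < (fStrong n S : ℝ) → ∑ i ∈ S, (p + ε • v) i ≤ (fStrong n S : ℝ) := by
    rw [Filter.eventually_all]
    intro S
    by_cases hS : ∑ i ∈ S, p i < (fStrong n S : ℝ)
    · have hc : Continuous fun ε : ℝ => ∑ i ∈ S, (p + ε • v) i := by
        simp only [Pi.add_apply, Pi.smul_apply, smul_eq_mul]
        fun_prop
      have h0 : (fun ε : ℝ => ∑ i ∈ S, (p + ε • v) i) 0 < (fStrong n S : ℝ) := by simpa using hS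
      have := (hc.tendsto 0).eventually_lt_const h0
      filter_upwards [nhdsWithin_le_nhds this] with ε hε _
      exact hε.le
    · exact Filter.Eventually.of_forall fun _ h => absurd h hS
  obtain ⟨ε, h1, h2⟩ := (h.and self_mem_nhdsWithin).exists
  exact ⟨ε, h2, h1⟩

lemma irredundant {n : ℕ} (X : Finset (Fin n)) (hX : X.Nonempty) (hXu : X ≠ Finset.univ) :
    ∃ x : Fin n → ℝ, (∑ i, x i) = 0 ∧
        (∀ Y : Finset (Fin n), Y.Nonempty → Y ≠ Finset.univ → Y ≠ X →
          (∑ i ∈ Y, x i) ≤ (fStrong n Y : ℝ)) ∧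
        (fStrong n X : ℝ) < ∑ i ∈ X, x i := by
  obtain ⟨p, h1, h2, h3, h4⟩ := exists_relint X
  obtain ⟨b, hb⟩ := hX
  obtain ⟨a, ha⟩ : ∃ w, w ∉ X := by
    by_contra h
    push Not at h
    exact hXu (Finset.eq_univ_iff_forall.2 h)
  obtain ⟨ε, hε, h⟩ := exists_eps p (rootVec b a)
  have hs : ∀ S, ∑ i ∈ S, (p + ε • rootVec b a) i
      = ∑ i ∈ S, p i + ε * ∑ i ∈ S, rootVec b a i := by
    intro S
    simp [Finset.sum_add_distrib, Finset.mul_sum]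
  refine ⟨p + ε • rootVec b a, ?_, fun Y hY hYu hYX => h Y (h4 Y hY hYu hYX), ?_⟩
  · rw [hs, h1, sum_rootVec]; simp
  · rw [hs, h2, sum_rootVec]; simp [ha, hb, hε]

/-- The functional `x ↦ ∑_{i ∈ S} x i`. -/
def sumFun {n : ℕ} (S : Finset (Fin n)) : (Fin n → ℝ) →ₗ[ℝ] ℝ := ∑ i ∈ S, LinearMap.proj i

lemma sumFun_apply {n : ℕ} (S : Finset (Fin n)) (x : Fin n → ℝ) :
    sumFun S x = ∑ i ∈ S, x i := by
  simp [sumFun]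

/-- The face of `SRP n` where the inequality of `X` is tight. -/
def tightFace (n : ℕ) (X : Finset (Fin n)) : Set (Fin n → ℝ) :=
  {x | x ∈ SRP n ∧ sumFun X x = (fStrong n X : ℝ)}

lemma mem_SRP {n : ℕ} {x : Fin n → ℝ} : x ∈ SRP n ↔ sumFun Finset.univ x = 0 ∧
    ∀ X : Finset (Fin n), X.Nonempty → X ≠ Finset.univ → sumFun X x ≤ (fStrong n X : ℝ) := by
  simp only [sumFun_apply]; rfl

lemma convex_SRP (n : ℕ) : Convex ℝ (SRP n) := by
  intro x hx y hy a b ha hb hab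
  rw [mem_SRP] at *
  refine ⟨by simp [hx.1, hy.1], fun X h1 h2 => ?_⟩
  have hx' := hx.2 X h1 h2
  have hy' := hy.2 X h1 h2
  rw [map_add, map_smul, map_smul, smul_eq_mul, smul_eq_mul]
  have : (fStrong n X : ℝ) = a * fStrong n X + b * fStrong n X := by rw [← add_mul, hab, one_mul]
  rw [this]
  gcongr

lemma isFace_tightFace {n : ℕ} {X : Finset (Fin n)} (hX : X.Nonempty) (hXu : X ≠ Finset.univ) :
    IsFaceOf (SRP n) (tightFace n X) := by
  refine ⟨fun x hx => hx.1, ?_, ?_⟩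
  · intro x hx y hy a b ha hb hab
    refine ⟨convex_SRP n hx.1 hy.1 ha hb hab, ?_⟩
    rw [map_add, map_smul, map_smul, smul_eq_mul, smul_eq_mul, hx.2, hy.2, ← add_mul, hab, one_mul]
  · intro x hx y hy t ht ht1 h
    have h1 := (mem_SRP.1 hx).2 X hX hXu
    have h2 := (mem_SRP.1 hy).2 X hX hXu
    have h3 := h.2
    rw [map_add, map_smul, map_smul, smul_eq_mul, smul_eq_mul] at h3
    have ht2 : 0 < 1 - t := by linarith
    refine ⟨⟨hx, le_antisymm h1 ?_⟩, ⟨hy, le_antisymm h2 ?_⟩⟩ <;> by_contra hc <;> push Not at hc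
    · nlinarith [mul_lt_mul_of_pos_left hc ht, mul_le_mul_of_nonneg_left h2 ht2.le]
    · nlinarith [mul_lt_mul_of_pos_left hc ht2, mul_le_mul_of_nonneg_left h1 ht.le]

lemma vectorSpan_SRP (n : ℕ) :
    vectorSpan ℝ (SRP n) = LinearMap.ker (sumFun (Finset.univ : Finset (Fin n))) := by
  apply le_antisymm
  · rw [vectorSpan_def, Submodule.span_le]
    rintro _ ⟨x, hx, y, hy, rfl⟩
    simp [(mem_SRP.1 hx).1, (mem_SRP.1 hy).1]
  · intro v hv
    rw [LinearMap.mem_ker] at hv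
    obtain ⟨p, h1, h2, h3, h4⟩ := exists_relint (∅ : Finset (Fin n))
    simp only [← sumFun_apply] at h1 h2 h3 h4
    obtain ⟨ε, hε, h⟩ := exists_eps p v
    simp only [← sumFun_apply] at h
    have hp : p ∈ SRP n := mem_SRP.2 ⟨h1, fun X _ _ => h3 X⟩
    have hp' : p + ε • v ∈ SRP n :=
      mem_SRP.2 ⟨by simp [h1, hv], fun X a b => h X (h4 X a b a.ne_empty)⟩
    have := vsub_mem_vectorSpan ℝ hp' hp
    rw [vsub_eq_sub, add_sub_cancel_left] at this
    exact (Submodule.smul_mem_iff _ hε.ne').1 this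

lemma vectorSpan_tightFace {n : ℕ} (X : Finset (Fin n)) :
    vectorSpan ℝ (tightFace n X) =
      LinearMap.ker (sumFun (Finset.univ : Finset (Fin n))) ⊓ LinearMap.ker (sumFun X) := by
  apply le_antisymm
  · rw [vectorSpan_def, Submodule.span_le]
    rintro _ ⟨x, hx, y, hy, rfl⟩
    simp [(mem_SRP.1 hx.1).1, (mem_SRP.1 hy.1).1, hx.2, hy.2]
  · rintro v ⟨hv, hvX⟩
    simp only [SetLike.mem_coe, LinearMap.mem_ker] at hv hvX
    obtain ⟨p, h1, h2, h3, h4⟩ := exists_relint X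
    simp only [← sumFun_apply] at h1 h2 h3 h4
    obtain ⟨ε, hε, h⟩ := exists_eps p v
    simp only [← sumFun_apply] at h
    have hp : p ∈ tightFace n X := ⟨mem_SRP.2 ⟨h1, fun X _ _ => h3 X⟩, h2⟩
    have hp' : p + ε • v ∈ tightFace n X := by
      refine ⟨mem_SRP.2 ⟨by simp [h1, hv], fun Y a b => ?_⟩, by simp [h2, hvX]⟩
      by_cases hY : Y = X
      · subst hY; simp [h2, hvX]
      · exact h Y (h4 Y a b hY)
    have := vsub_mem_vectorSpan ℝ hp' hp
    rw [vsub_eq_sub, add_sub_cancel_left] at this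
    exact (Submodule.smul_mem_iff _ hε.ne').1 this

lemma finrank_tightFace {n : ℕ} {X : Finset (Fin n)} (hX : X.Nonempty) (hXu : X ≠ Finset.univ) :
    Module.finrank ℝ (vectorSpan ℝ (tightFace n X)) + 1
      = Module.finrank ℝ (vectorSpan ℝ (SRP n)) := by
  rw [vectorSpan_SRP, vectorSpan_tightFace]
  set V := LinearMap.ker (sumFun (Finset.univ : Finset (Fin n))) with hV
  obtain ⟨b, hb⟩ := hX
  obtain ⟨a, ha⟩ : ∃ w, w ∉ X := by
    by_contra h
    push Not at h
    exact hXu (Finset.eq_univ_iff_forall.2 h)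
  let φ : V →ₗ[ℝ] ℝ := (sumFun X).domRestrict V
  have hker : V ⊓ LinearMap.ker (sumFun X) = (LinearMap.ker φ).map V.subtype := by
    ext v
    simp [φ, and_comm]
  have hsurj : LinearMap.range φ = ⊤ := by
    rw [LinearMap.range_eq_top]
    intro t
    have hm : t • rootVec b a ∈ V := by
      rw [hV, LinearMap.mem_ker, map_smul, sumFun_apply, sum_rootVec]; simp
    refine ⟨⟨_, hm⟩, ?_⟩
    change sumFun X (t • rootVec b a) = t
    rw [map_smul, sumFun_apply, sum_rootVec]
    simp [ha, hb]
  have h := LinearMap.finrank_range_add_finrank_ker φ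
  rw [hsurj, finrank_top, Module.finrank_self] at h
  rw [hker, LinearEquiv.finrank_eq (Submodule.equivMapOfInjective V.subtype
    V.injective_subtype (LinearMap.ker φ)).symm]
  omega

lemma isFacet_tightFace {n : ℕ} {X : Finset (Fin n)} (hX : X.Nonempty) (hXu : X ≠ Finset.univ) :
    IsFacetOf (SRP n) (tightFace n X) := by
  refine ⟨isFace_tightFace hX hXu, ?_, finrank_tightFace hX hXu⟩
  obtain ⟨p, h1, h2, h3, h4⟩ := exists_relint X
  simp only [← sumFun_apply] at h1 h2 h3 h4
  exact ⟨p, mem_SRP.2 ⟨h1, fun X _ _ => h3 X⟩, h2⟩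

/-- A point of `F` beyond which every segment from `y` can be prolonged forces `y ∈ F`. -/
lemma mem_face_of_prolong {n : ℕ} {P F : Set (Fin n → ℝ)} (hF : IsFaceOf P F) {y z : Fin n → ℝ}
    (hy : y ∈ P) (hz : z ∈ F) {ε : ℝ} (hε : 0 < ε) (h : z + ε • (z - y) ∈ P) : y ∈ F := by
  have h1 : 0 < 1 + ε := by linarith
  refine (hF.2.2 y hy _ h (ε / (1 + ε)) (by positivity) ?_ ?_).1
  · rw [div_lt_one h1]; linarith
  · convert hz using 1
    ext i
    simp only [Pi.add_apply, Pi.smul_apply, Pi.sub_apply, smul_eq_mul]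
    field_simp
    ring

lemma face_subset_tight {n : ℕ} {F : Set (Fin n → ℝ)} (hF : IsFacetOf (SRP n) F) :
    ∃ X : Finset (Fin n), X.Nonempty ∧ X ≠ Finset.univ ∧ F ⊆ tightFace n X := by
  obtain ⟨hface, ⟨z0, hz0⟩, hdim⟩ := hF
  by_contra hcon
  push Not at hcon
  have h : ∀ X : Finset (Fin n), ∃ z ∈ F,
      X.Nonempty → X ≠ Finset.univ → sumFun X z < (fStrong n X : ℝ) := by
    intro X
    by_cases hX : X.Nonempty ∧ X ≠ Finset.univ
    · obtain ⟨z, hz, hzX⟩ := Set.not_subset.1 (hcon X hX.1 hX.2)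
      refine ⟨z, hz, fun a b => ?_⟩
      have hzP := hface.1 hz
      exact lt_of_le_of_ne ((mem_SRP.1 hzP).2 X a b) fun h => hzX ⟨hzP, h⟩
    · exact ⟨z0, hz0, fun a b => absurd ⟨a, b⟩ hX⟩
  choose z hz hlt using h
  set N : ℝ := (Fintype.card (Finset (Fin n)) : ℝ) with hN
  have hNpos : 0 < N := by rw [hN]; exact_mod_cast Fintype.card_pos
  have hconst : ∀ c : ℝ, ∑ _Z : Finset (Fin n), c = c * N := by
    intro c
    rw [Finset.sum_const, nsmul_eq_mul, Finset.card_univ, hN, mul_comm]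
  set w : Fin n → ℝ := ∑ Z : Finset (Fin n), (1 / N) • z Z with hw
  have hwF : w ∈ F := by
    refine hface.2.1.sum_mem (fun _ _ => by positivity) ?_ fun Z _ => hz Z
    rw [hconst]; field_simp
  have hwlt : ∀ Y : Finset (Fin n), Y.Nonempty → Y ≠ Finset.univ →
      sumFun Y w < (fStrong n Y : ℝ) := by
    intro Y hY hYu
    have : sumFun Y w = (∑ Z, sumFun Y (z Z)) / N := by
      rw [hw, map_sum, Finset.sum_div]
      refine Finset.sum_congr rfl fun Z _ => ?_
      rw [map_smul, smul_eq_mul]; ring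
    rw [this, div_lt_iff₀ hNpos, ← hconst]
    exact Finset.sum_lt_sum (fun Z _ => (mem_SRP.1 (hface.1 (hz Z))).2 Y hY hYu)
      ⟨Y, Finset.mem_univ _, hlt Y hY hYu⟩
  have hFP : F = SRP n := by
    refine Set.Subset.antisymm hface.1 fun y hy => ?_
    obtain ⟨ε, hε, h⟩ := exists_eps w (w - y)
    simp only [← sumFun_apply] at h
    refine mem_face_of_prolong hface hy hwF hε (mem_SRP.2 ⟨?_, fun Y a b => h Y (hwlt Y a b)⟩)
    simp [(mem_SRP.1 hy).1, (mem_SRP.1 (hface.1 hwF)).1]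
  rw [hFP] at hdim
  omega

lemma facet_eq_tight {n : ℕ} {F : Set (Fin n → ℝ)} (hF : IsFacetOf (SRP n) F) :
    ∃ X : Finset (Fin n), X.Nonempty ∧ X ≠ Finset.univ ∧ F = tightFace n X := by
  obtain ⟨X, hX, hXu, hsub⟩ := face_subset_tight hF
  refine ⟨X, hX, hXu, Set.Subset.antisymm hsub fun y hy => ?_⟩
  obtain ⟨hface, hne, hdim⟩ := hF
  have hspan : vectorSpan ℝ F = vectorSpan ℝ (tightFace n X) := by
    refine Submodule.eq_of_le_of_finrank_eq (vectorSpan_mono ℝ hsub) ?_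
    have := finrank_tightFace hX hXu
    omega
  obtain ⟨_, ⟨z, hz, rfl⟩⟩ := hne.intrinsicInterior hface.2.1
  have hzF : (z : Fin n → ℝ) ∈ F :=
    (interior_subset hz : z ∈ ((↑) ⁻¹' F : Set (affineSpan ℝ F)))
  have hdir : (z : Fin n → ℝ) - y ∈ vectorSpan ℝ F := by
    rw [hspan]
    exact vsub_mem_vectorSpan ℝ (hsub hzF) hy
  have hmem : ∀ ε : ℝ, (z : Fin n → ℝ) + ε • ((z : Fin n → ℝ) - y) ∈ affineSpan ℝ F := by
    intro ε
    have h1 : ε • ((z : Fin n → ℝ) - y) ∈ (affineSpan ℝ F).direction := by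
      rw [direction_affineSpan]; exact Submodule.smul_mem _ _ hdir
    have := AffineSubspace.vadd_mem_of_mem_direction h1 z.2
    rwa [vadd_eq_add, add_comm] at this
  let g : ℝ → affineSpan ℝ F := fun ε => ⟨_, hmem ε⟩
  have hg : Continuous g := by
    refine Continuous.subtype_mk ?_ _
    fun_prop
  have hg0 : g 0 = z := Subtype.ext (by simp [g])
  have hev : ∀ᶠ ε in nhds (0 : ℝ), g ε ∈ interior ((↑) ⁻¹' F : Set (affineSpan ℝ F)) := by
    refine hg.continuousAt.eventually_mem (isOpen_interior.mem_nhds ?_)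
    rwa [hg0]
  have hev' : ∀ᶠ ε in nhdsWithin (0 : ℝ) (Set.Ioi 0),
      g ε ∈ interior ((↑) ⁻¹' F : Set (affineSpan ℝ F)) := nhdsWithin_le_nhds hev
  obtain ⟨ε, h1, h2⟩ := (hev'.and self_mem_nhdsWithin).exists
  have h3 : g ε ∈ ((↑) ⁻¹' F : Set (affineSpan ℝ F)) := interior_subset h1
  exact mem_face_of_prolong hface hy.1 hzF h2 (hface.1 h3)

lemma tightFace_inj {n : ℕ} {X Y : Finset (Fin n)} (hY : Y.Nonempty)
    (hYu : Y ≠ Finset.univ) (h : tightFace n X = tightFace n Y) : X = Y := by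
  by_contra hne
  obtain ⟨p, h1, h2, h3, h4⟩ := exists_relint X
  simp only [← sumFun_apply] at h1 h2 h3 h4
  have hp : p ∈ tightFace n X := ⟨mem_SRP.2 ⟨h1, fun X _ _ => h3 X⟩, h2⟩
  rw [h] at hp
  exact (h4 Y hY hYu (Ne.symm hne)).ne hp.2

lemma ncard_facets (n : ℕ) (hn : 2 ≤ n) :
    {F : Set (Fin n → ℝ) | IsFacetOf (SRP n) F}.ncard = 2 ^ n - 2 := by
  have hset : {F : Set (Fin n → ℝ) | IsFacetOf (SRP n) F} =
      tightFace n '' (((Finset.univ.erase ∅).erase Finset.univ : Finset (Finset (Fin n))) :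
        Set (Finset (Fin n))) := by
    ext F
    constructor
    · intro hF
      obtain ⟨X, h1, h2, h3⟩ := facet_eq_tight hF
      exact ⟨X, by simp [h2, h1.ne_empty], h3.symm⟩
    · rintro ⟨X, hX, rfl⟩
      simp at hX
      exact isFacet_tightFace (Finset.nonempty_iff_ne_empty.2 hX.1) hX.2
  rw [hset, Set.InjOn.ncard_image, Set.ncard_coe_finset, Finset.card_erase_of_mem,
    Finset.card_erase_of_mem (Finset.mem_univ _), Finset.card_univ, Fintype.card_finset,
    Fintype.card_fin, Nat.sub_sub]
  · have : Nonempty (Fin n) := ⟨⟨0, by omega⟩⟩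
    simp [Finset.univ_nonempty.ne_empty]
  · intro X _ Y hY h
    simp at hY
    exact tightFace_inj (Finset.nonempty_iff_ne_empty.2 hY.1) hY.2 h

/-- the facet description of the strong rectangulotope is
irredundant: for every nonempty proper `X ⊊ [n]` there is a point satisfying
all other inequalities but violating the one of `X`.  Consequently `SRP(n)`
has exactly `2^n − 2` facets. -/
theorem strong_rectangulotope_facets (n : ℕ) (hn : 2 ≤ n) :
    (∀ X : Finset (Fin n), X.Nonempty → X ≠ Finset.univ →
      ∃ x : Fin n → ℝ, (∑ i, x i) = 0 ∧
        (∀ Y : Finset (Fin n), Y.Nonempty → Y ≠ Finset.univ → Y ≠ X →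
          (∑ i ∈ Y, x i) ≤ (fStrong n Y : ℝ)) ∧
        (fStrong n X : ℝ) < ∑ i ∈ X, x i) ∧
    {F : Set (Fin n → ℝ) | IsFacetOf (SRP n) F}.ncard = 2 ^ n - 2 := by
  exact ⟨irredundant, ncard_facets n hn⟩

end
end

section
/- For every n ≥ 1, the set function f_≍ : 2^{[n]} → ℤ defined by f_≍(X) = #{I interval of [n] : I ⊄ X and I ⊄ [n]∖X} is submodular: f_≍(X ∪ Y) + f_≍(X ∩ Y) ≤ f_≍(X) + f_≍(Y) for all X, Y ⊆ [n]. -/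
open Classical Pointwise

noncomputable section

/-- the set function `f_≍` realizing the weak rectangulotope
is submodular. -/
theorem fWeak_submodular (n : ℕ) (hn : 1 ≤ n) (X Y : Finset (Fin n)) :
    (fWeak n (X ∪ Y) : ℤ) + (fWeak n (X ∩ Y) : ℤ) ≤ (fWeak n X : ℤ) + (fWeak n Y : ℤ) := by
  unfold fWeak
  set P := {I : Finset (Fin n) | IsInterval I ∧ ¬ I ⊆ X ∪ Y ∧ ¬ I ⊆ (X ∪ Y)ᶜ} with hP
  set Q := {I : Finset (Fin n) | IsInterval I ∧ ¬ I ⊆ X ∩ Y ∧ ¬ I ⊆ (X ∩ Y)ᶜ} with hQ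
  set A := {I : Finset (Fin n) | IsInterval I ∧ ¬ I ⊆ X ∧ ¬ I ⊆ Xᶜ} with hA
  set B := {I : Finset (Fin n) | IsInterval I ∧ ¬ I ⊆ Y ∧ ¬ I ⊆ Yᶜ} with hB
  have h1 : P ∪ Q ⊆ A ∪ B := by
    intro I
    simp only [hP, hQ, hA, hB, Set.mem_union, Set.mem_setOf_eq, Finset.subset_iff,
      Finset.mem_union, Finset.mem_inter, Finset.mem_compl]
    grind
  have h2 : P ∩ Q ⊆ A ∩ B := by
    intro I
    simp only [hP, hQ, hA, hB, Set.mem_inter_iff, Set.mem_setOf_eq, Finset.subset_iff,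
      Finset.mem_union, Finset.mem_inter, Finset.mem_compl]
    grind
  have e1 := Set.ncard_union_add_ncard_inter P Q
  have e2 := Set.ncard_union_add_ncard_inter A B
  have l1 := Set.ncard_le_ncard h1 (Set.toFinite _)
  have l2 := Set.ncard_le_ncard h2 (Set.toFinite _)
  omega

end
end

section
/- For every n ≥ 1, the set function f_⥮ : 2^{[n]} → ℤ defined by f_⥮(X) = #{(I,J) : I ⊄ X and J ⊄ [n]∖X} + #{(I,J) : I ⊄ [n]∖X and J ⊄ X}, where (I,J) ranges over all pairs of nonempty consecutive intervals of [n], is submodular: f_⥮(X ∪ Y) + f_⥮(X ∩ Y) ≤ f_⥮(X) + f_⥮(Y) for all X, Y ⊆ [n]. -/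
open Classical Pointwise

noncomputable section

/-- Logical relations between the containments of a nonempty set I. -/
lemma aux_cases {n : ℕ} (I X Y : Finset (Fin n)) (hI : I.Nonempty) :
    (I ⊆ X ∩ Y ↔ I ⊆ X ∧ I ⊆ Y) ∧ (I ⊆ (X ∪ Y)ᶜ ↔ I ⊆ Xᶜ ∧ I ⊆ Yᶜ) ∧
    (I ⊆ X → I ⊆ X ∪ Y) ∧ (I ⊆ Y → I ⊆ X ∪ Y) ∧
    (I ⊆ Xᶜ → I ⊆ (X ∩ Y)ᶜ) ∧ (I ⊆ Yᶜ → I ⊆ (X ∩ Y)ᶜ) ∧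
    (I ⊆ Xᶜ → I ⊆ X ∪ Y → I ⊆ Y) ∧ (I ⊆ Yᶜ → I ⊆ X ∪ Y → I ⊆ X) ∧
    (I ⊆ X → I ⊆ (X ∩ Y)ᶜ → I ⊆ Yᶜ) ∧ (I ⊆ Y → I ⊆ (X ∩ Y)ᶜ → I ⊆ Xᶜ) ∧
    ¬ (I ⊆ X ∧ I ⊆ Xᶜ) ∧ ¬ (I ⊆ Y ∧ I ⊆ Yᶜ) := by
  obtain ⟨a, ha⟩ := hI
  simp only [Finset.subset_iff, Finset.mem_inter, Finset.mem_union, Finset.mem_compl]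
  refine ⟨?_, ?_, ?_, ?_, ?_, ?_, ?_, ?_, ?_, ?_, ?_, ?_⟩ <;> grind

/-- The contribution of one pair of intervals. -/
def pairVal {n : ℕ} (I J X : Finset (Fin n)) : ℕ :=
  (if ¬ I ⊆ X ∧ ¬ J ⊆ Xᶜ then 1 else 0) + (if ¬ I ⊆ Xᶜ ∧ ¬ J ⊆ X then 1 else 0)

lemma pairVal_submodular {n : ℕ} (I J X Y : Finset (Fin n)) (hI : I.Nonempty)
    (hJ : J.Nonempty) :
    pairVal I J (X ∪ Y) + pairVal I J (X ∩ Y) ≤ pairVal I J X + pairVal I J Y := by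
  have h1 := aux_cases I X Y hI
  have h2 := aux_cases J X Y hJ
  unfold pairVal
  obtain ⟨h, h', h1⟩ := h1
  obtain ⟨k, k', h2⟩ := h2
  simp only [h, h', k, k']
  clear h h' k k'
  by_cases a5 : I ⊆ X <;> by_cases a6 : I ⊆ Y <;> by_cases a7 : I ⊆ Xᶜ <;>
  by_cases a8 : I ⊆ Yᶜ <;> simp only [a5, a6, a7, a8] at h1 <;>
  by_cases b5 : J ⊆ X <;> by_cases b6 : J ⊆ Y <;> by_cases b7 : J ⊆ Xᶜ <;>
  by_cases b8 : J ⊆ Yᶜ <;> simp only [b5, b6, b7, b8] at h2 <;>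
  grind

lemma fStrong_eq (n : ℕ) (X : Finset (Fin n)) :
    fStrong n X = ∑ p : Finset (Fin n) × Finset (Fin n) with ConsecIntervals p.1 p.2,
      pairVal p.1 p.2 X := by
  unfold fStrong pairVal
  rw [Finset.sum_add_distrib]
  simp only [Set.ncard_eq_toFinset_card', Finset.sum_boole, Finset.filter_filter,
    Set.toFinset_ofPred, Nat.cast_id]

/-- the set function `f_⥮` realizing the strong
rectangulotope is submodular. -/
theorem fStrong_submodular (n : ℕ) (hn : 1 ≤ n) (X Y : Finset (Fin n)) :
    (fStrong n (X ∪ Y) : ℤ) + (fStrong n (X ∩ Y) : ℤ) ≤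
      (fStrong n X : ℤ) + (fStrong n Y : ℤ) := by
  rw [fStrong_eq, fStrong_eq, fStrong_eq, fStrong_eq]
  norm_cast
  rw [← Finset.sum_add_distrib, ← Finset.sum_add_distrib]
  apply Finset.sum_le_sum
  intro p hp
  obtain ⟨hI, hJ, -⟩ := (Finset.mem_filter.mp hp).2
  exact pairVal_submodular _ _ _ _ hI.1 hJ.1

end
end
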